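/- Proposition 2 for a single-level U-Net: fix a real p ≥ 1. Let F_e⁰, F_e¹ : (ℤ → ℝ) → (ℤ → ℝ) be shift equivariant (Fᵉ(T_m z) = T_m(Fᵉ z) for all z, m), and let F_d⁰ : (ℤ → ℝ) × (ℤ → ℝ) → (ℤ → ℝ) be jointly shift equivariant (F_d⁰(T_m u, T_m v) = T_m(F_d⁰(u, v)) for all u, v, m). Let x : ℤ → ℝ be such that s := F_e⁰(x) has both polyphase components in ℓp(ℤ) with ‖poly₀(s)‖_p ≠ ‖poly₁(s)‖_p. Define the network output N(x) = F_d⁰( F_e⁰(x), U^A₂( F_e¹( D^A₂(F_e⁰(x)) ), i_{F_e⁰(x)} ) ). Then for every integer k, N(T_k x) = T_k(N(x)). -/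

import Mathlib

noncomputable section

/-- Shift operator: `(T k x) n = x (n - k)`. -/
def T (k : ℤ) (x : ℤ → ℝ) : ℤ → ℝ := fun n => x (n - k)

/-- Stride-2 downsampling. -/
def D2 (x : ℤ → ℝ) : ℤ → ℝ := fun n => x (2 * n)

/-- Stride-2 upsampling. -/
def U2 (y : ℤ → ℝ) : ℤ → ℝ := fun n => if (2 : ℤ) ∣ n then y (n / 2) else 0

/-- Even polyphase component. -/
def poly0 (x : ℤ → ℝ) : ℤ → ℝ := fun n => x (2 * n)

/-- Odd polyphase component. -/
def poly1 (x : ℤ → ℝ) : ℤ → ℝ := fun n => x (2 * n + 1)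

/-- Membership in ℓp(ℤ): summability of |f|^p. -/
def Memlp (p : ℝ) (f : ℤ → ℝ) : Prop := Summable (fun n => |f n| ^ p)

/-- The ℓp norm of a signal. -/
def lpNorm (p : ℝ) (f : ℤ → ℝ) : ℝ := (∑' n, |f n| ^ p) ^ (1 / p)

/-- APS index: the index of the polyphase component with larger ℓp norm. -/
def apsIndex (p : ℝ) (x : ℤ → ℝ) : ℤ :=
  if lpNorm p (poly0 x) < lpNorm p (poly1 x) then 1 else 0

/-- Adaptive polyphase downsampling: the polyphase component with larger ℓp norm. -/
def apsD (p : ℝ) (x : ℤ → ℝ) : ℤ → ℝ :=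
  if lpNorm p (poly0 x) < lpNorm p (poly1 x) then poly1 x else poly0 x

/-- Adaptive polyphase upsampling with grid index `i`. -/
def apsU (i : ℤ) (y : ℤ → ℝ) : ℤ → ℝ := T i (U2 y)

theorem T_T (a b : ℤ) (x : ℤ → ℝ) : T a (T b x) = T (a + b) x := by
  funext n
  simp only [T]
  congr 1
  ring

theorem U2_T (k : ℤ) (y : ℤ → ℝ) : U2 (T k y) = T (2 * k) (U2 y) := by
  funext n
  simp only [U2, T]
  have hdvd : (2 : ℤ) ∣ n - 2 * k ↔ 2 ∣ n := by omega
  have hdiv : (n - 2 * k) / 2 = n / 2 - k := by omega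
  simp only [hdvd, hdiv]

theorem apsU_T (i k : ℤ) (y : ℤ → ℝ) : apsU i (T k y) = T (i + 2 * k) (U2 y) := by
  rw [apsU, U2_T, T_T]

theorem T_apsU (k i : ℤ) (y : ℤ → ℝ) : T k (apsU i y) = T (k + i) (U2 y) := by
  rw [apsU, T_T]

theorem lpNorm_T (p : ℝ) (k : ℤ) (f : ℤ → ℝ) : lpNorm p (T k f) = lpNorm p f := by
  unfold lpNorm
  congr 1
  exact (Equiv.subRight k).tsum_eq fun n => |f n| ^ p

theorem poly0_T_even (m : ℤ) (s : ℤ → ℝ) : poly0 (T (2 * m) s) = T m (poly0 s) := by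
  funext n
  simp only [poly0, T]
  congr 1
  ring

theorem poly1_T_even (m : ℤ) (s : ℤ → ℝ) : poly1 (T (2 * m) s) = T m (poly1 s) := by
  funext n
  simp only [poly1, T]
  congr 1
  ring

theorem poly0_T_odd (m : ℤ) (s : ℤ → ℝ) :
    poly0 (T (2 * m + 1) s) = T (m + 1) (poly1 s) := by
  funext n
  simp only [poly0, poly1, T]
  congr 1
  ring

theorem poly1_T_odd (m : ℤ) (s : ℤ → ℝ) : poly1 (T (2 * m + 1) s) = T m (poly0 s) := by
  funext n
  simp only [poly0, poly1, T]
  congr 1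
  ring

/-- Adaptive down- and upsampling around a shift equivariant map is shift equivariant. -/
theorem apsU_apsD_T (p : ℝ) (F : (ℤ → ℝ) → (ℤ → ℝ))
    (hF : ∀ (z : ℤ → ℝ) (m : ℤ), F (T m z) = T m (F z)) (s : ℤ → ℝ)
    (hne : lpNorm p (poly0 s) ≠ lpNorm p (poly1 s)) (k : ℤ) :
    apsU (apsIndex p (T k s)) (F (apsD p (T k s))) =
      T k (apsU (apsIndex p s) (F (apsD p s))) := by
  obtain ⟨m, rfl | rfl⟩ := Int.even_or_odd' k
  · unfold apsIndex apsD
    simp only [poly0_T_even, poly1_T_even, lpNorm_T]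
    split_ifs <;> rw [hF, apsU_T, T_apsU] <;> congr 1 <;> ring
  · unfold apsIndex apsD
    simp only [poly0_T_odd, poly1_T_odd, lpNorm_T]
    rcases hne.lt_or_gt with h | h
    all_goals
      simp only [h, h.not_gt, if_true, if_false]
      rw [hF, apsU_T, T_apsU]
      congr 1
      ring

theorem single_level_unet_shift_equivariant (p : ℝ) (hp : 1 ≤ p)
    (Fe0 Fe1 : (ℤ → ℝ) → (ℤ → ℝ))
    (Fd0 : (ℤ → ℝ) → (ℤ → ℝ) → (ℤ → ℝ))
    (hFe0 : ∀ (z : ℤ → ℝ) (m : ℤ), Fe0 (T m z) = T m (Fe0 z))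
    (hFe1 : ∀ (z : ℤ → ℝ) (m : ℤ), Fe1 (T m z) = T m (Fe1 z))
    (hFd0 : ∀ (u v : ℤ → ℝ) (m : ℤ), Fd0 (T m u) (T m v) = T m (Fd0 u v))
    (x : ℤ → ℝ)
    (h0 : Memlp p (poly0 (Fe0 x))) (h1 : Memlp p (poly1 (Fe0 x)))
    (hne : lpNorm p (poly0 (Fe0 x)) ≠ lpNorm p (poly1 (Fe0 x))) :
    ∀ k : ℤ,
      Fd0 (Fe0 (T k x))
          (apsU (apsIndex p (Fe0 (T k x))) (Fe1 (apsD p (Fe0 (T k x))))) =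
        T k (Fd0 (Fe0 x) (apsU (apsIndex p (Fe0 x)) (Fe1 (apsD p (Fe0 x))))) := by
  intro k
  rw [hFe0, apsU_apsD_T p Fe1 hFe1 _ hne, hFd0]
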